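/- Let Δ ∈ (0,1), σ > 0, d ≥ 1, and μ ∈ ℝ^d with ‖μ‖ = 1. Set τ² := (1−Δ)σ² + Δ, b := √(1−Δ)σ²/τ², a := Δ/τ². Let s be uniform on {−1,+1}, η ~ N(0, I_d), ξ ~ N(0, I_d) all independent, x := s·μ + σ·η, x̃ := √(1−Δ)x + √Δξ, and define the oracle denoiser t(y) := b·y + a·tanh(√(1−Δ)·μᵀy/τ²)·μ. Then the exact identity E‖x − t(x̃)‖² = d·Δ·b² + (1−√(1−Δ)b)²·(1 + d·σ²) + a²·E_z[ tanh²( ((1−Δ) + √(1−Δ)·τ·z)/τ² ) ] − 2a·(1−√(1−Δ)b)·E_z[ tanh( ((1−Δ) + √(1−Δ)·τ·z)/τ² ) ] holds, where z ~ N(0,1). -/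

import Mathlib

open MeasureTheory
open scoped RealInnerProductSpace

/-- Standard Gaussian density `N(v; 0, I_d)` on `ℝ^d`. -/
noncomputable def stdGaussVec (d : ℕ) (v : EuclideanSpace ℝ (Fin d)) : ℝ :=
  (2 * Real.pi) ^ (-(d : ℝ) / 2) * Real.exp (-‖v‖ ^ 2 / 2)

/-- Standard Gaussian density `N(z; 0, 1)` on `ℝ`. -/
noncomputable def stdGauss1 (z : ℝ) : ℝ :=
  (2 * Real.pi) ^ (-(1 : ℝ) / 2) * Real.exp (-z ^ 2 / 2)

open ProbabilityTheory

lemma continuous_stdGaussVec (d : ℕ) : Continuous (stdGaussVec d) := by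
  unfold stdGaussVec
  fun_prop

lemma stdGaussVec_nonneg (d : ℕ) (v : EuclideanSpace ℝ (Fin d)) : 0 ≤ stdGaussVec d v := by
  unfold stdGaussVec
  positivity

lemma ofReal_stdGaussVec_mul_cexp (d : ℕ) (v w : EuclideanSpace ℝ (Fin d)) :
    (stdGaussVec d v : ℂ) * Complex.exp (⟪v, w⟫ * Complex.I) =
      (((2 * Real.pi) ^ (-(d : ℝ) / 2) : ℝ) : ℂ) *
        Complex.exp (-(1 / 2 : ℂ) * ‖v‖ ^ 2 + Complex.I * ⟪w, v⟫) := by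
  rw [stdGaussVec, Complex.ofReal_mul, mul_assoc, Complex.ofReal_exp, ← Complex.exp_add,
    real_inner_comm]
  congr 2
  push_cast
  ring

lemma integrable_stdGaussVec (d : ℕ) : Integrable (stdGaussVec d) := by
  have h := ((GaussianFourier.integrable_cexp_neg_mul_sq_norm_add (b := 1 / 2) (by norm_num)
    Complex.I (0 : EuclideanSpace ℝ (Fin d))).const_mul
      (((2 * Real.pi) ^ (-(d : ℝ) / 2) : ℝ) : ℂ)).re
  refine h.congr (Filter.Eventually.of_forall fun v ↦ ?_)
  have := ofReal_stdGaussVec_mul_cexp d v 0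
  simp only [inner_zero_right, Complex.ofReal_zero, zero_mul, Complex.exp_zero, mul_one] at this
  simp only [← this, RCLike.re_to_complex, Complex.ofReal_re]

lemma stdGaussian_eq_withDensity (d : ℕ) :
    stdGaussian (EuclideanSpace ℝ (Fin d)) =
      volume.withDensity fun v ↦ ENNReal.ofReal (stdGaussVec d v) := by
  have : IsFiniteMeasure ((volume : Measure (EuclideanSpace ℝ (Fin d))).withDensity
      fun v ↦ ENNReal.ofReal (stdGaussVec d v)) :=
    isFiniteMeasure_withDensity_ofReal (integrable_stdGaussVec d).2
  refine Measure.ext_of_charFun (funext fun w ↦ ?_)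
  rw [charFun_stdGaussian, charFun_apply, integral_withDensity_eq_integral_toReal_smul
    (continuous_stdGaussVec d).measurable.ennreal_ofReal (by simp)]
  simp_rw [ENNReal.toReal_ofReal (stdGaussVec_nonneg d _), Complex.real_smul,
    ofReal_stdGaussVec_mul_cexp]
  rw [integral_const_mul, GaussianFourier.integral_cexp_neg_mul_sq_norm_add (by norm_num),
    ← mul_assoc]
  have hpi : ((((2 * Real.pi) ^ (-(d : ℝ) / 2) : ℝ) : ℂ) *
      (Real.pi / (1 / 2 : ℂ)) ^ ((Module.finrank ℝ (EuclideanSpace ℝ (Fin d)) : ℂ) / 2)) = 1 := by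
    have h2 : (Real.pi / (1 / 2 : ℂ)) = ((2 * Real.pi : ℝ) : ℂ) := by
      push_cast
      ring
    have h3 : ((Module.finrank ℝ (EuclideanSpace ℝ (Fin d)) : ℂ) / 2) = ((d / 2 : ℝ) : ℂ) := by
      simp
    rw [h2, h3, ← Complex.ofReal_cpow (by positivity), ← Complex.ofReal_mul,
      ← Real.rpow_add (by positivity), neg_div, neg_add_cancel, Real.rpow_zero, Complex.ofReal_one]
  rw [hpi, one_mul, Complex.I_sq]
  congr 1
  ring

lemma integral_stdGaussVec_mul (d : ℕ) (f : EuclideanSpace ℝ (Fin d) → ℝ) :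
    ∫ v, stdGaussVec d v * f v = ∫ v, f v ∂stdGaussian (EuclideanSpace ℝ (Fin d)) := by
  rw [stdGaussian_eq_withDensity, integral_withDensity_eq_integral_toReal_smul
    (continuous_stdGaussVec d).measurable.ennreal_ofReal (by simp)]
  simp_rw [ENNReal.toReal_ofReal (stdGaussVec_nonneg d _), smul_eq_mul]

lemma integral_stdGauss1_mul (f : ℝ → ℝ) :
    ∫ z, stdGauss1 z * f z = ∫ z, f z ∂gaussianReal 0 1 := by
  rw [integral_gaussianReal_eq_integral_smul one_ne_zero]
  congr with z
  rw [smul_eq_mul, stdGauss1, gaussianPDFReal, Real.sqrt_eq_rpow, ← Real.rpow_neg (by positivity)]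
  norm_num

section stdGaussian

variable {E : Type*} [NormedAddCommGroup E] [InnerProductSpace ℝ E] [FiniteDimensional ℝ E]
  [MeasurableSpace E] [BorelSpace E]

lemma integral_inner_stdGaussian (w : E) : ∫ v, ⟪w, v⟫ ∂stdGaussian E = 0 :=
  integral_strongDual_stdGaussian (innerSL ℝ w)

lemma integrable_inner_stdGaussian (w : E) : Integrable (fun v ↦ ⟪w, v⟫) (stdGaussian E) :=
  (innerSL ℝ w).integrable_comp IsGaussian.integrable_id

lemma map_inner_stdGaussian {w : E} (hw : ‖w‖ = 1) :
    (stdGaussian E).map (fun v ↦ ⟪w, v⟫) = gaussianReal 0 1 := by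
  have h := IsGaussian.map_eq_gaussianReal (μ := stdGaussian E) (innerSL ℝ w)
  rw [integral_strongDual_stdGaussian, variance_dual_stdGaussian, innerSL_apply_norm, hw] at h
  simpa using h

lemma integrable_norm_sq_stdGaussian : Integrable (fun v : E ↦ ‖v‖ ^ 2) (stdGaussian E) :=
  (IsGaussian.memLp_two_id (μ := stdGaussian E)).integrable_norm_pow two_ne_zero

lemma integral_inner_sq_stdGaussian (w : E) : ∫ v, ⟪w, v⟫ ^ 2 ∂stdGaussian E = ‖w‖ ^ 2 := by
  have h := variance_dual_stdGaussian (innerSL ℝ w)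
  rwa [variance_of_integral_eq_zero (by fun_prop) (integral_strongDual_stdGaussian _),
    innerSL_apply_norm] at h

lemma integral_norm_sq_stdGaussian :
    ∫ v, ‖v‖ ^ 2 ∂stdGaussian E = Module.finrank ℝ E := by
  simp_rw [← (stdOrthonormalBasis ℝ E).sum_sq_inner_right]
  rw [integral_finsetSum]
  · simp [integral_inner_sq_stdGaussian]
  · intro i _
    exact ((innerSL ℝ (stdOrthonormalBasis ℝ E i)).comp_memLp'
      (IsGaussian.memLp_two_id (μ := stdGaussian E))).integrable_sq

lemma measurePreserving_rotation_stdGaussian (θ : ℝ) :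
    MeasurePreserving (ContinuousLinearMap.rotation (E := E) θ)
      ((stdGaussian E).prod (stdGaussian E)) ((stdGaussian E).prod (stdGaussian E)) where
  measurable := by fun_prop
  map_eq := IsGaussian.map_rotation_eq_self (integral_id_stdGaussian (E := E)) θ

/-- The second moment of `w(⟪m, u⟫) m - κ v` for independent standard Gaussian `u`, `v`. -/
lemma integral_norm_sq_smul_sub_smul {m : E} (hm : ‖m‖ = 1) (κ : ℝ) {w : ℝ → ℝ}
    (hw : Measurable w) {C : ℝ} (hC : ∀ z, |w z| ≤ C) :
    Integrable (fun p : E × E ↦ ‖w ⟪m, p.1⟫ • m - κ • p.2‖ ^ 2)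
        ((stdGaussian E).prod (stdGaussian E)) ∧
      ∫ p : E × E, ‖w ⟪m, p.1⟫ • m - κ • p.2‖ ^ 2 ∂(stdGaussian E).prod (stdGaussian E) =
        ∫ z, w z ^ 2 ∂gaussianReal 0 1 + κ ^ 2 * Module.finrank ℝ E := by
  have hmeas : Measurable fun u : E ↦ w ⟪m, u⟫ := hw.comp (by fun_prop)
  have hint : Integrable (fun u : E ↦ w ⟪m, u⟫) (stdGaussian E) :=
    .of_bound hmeas.aestronglyMeasurable C (.of_forall fun u ↦ hC _)
  have hint2 : Integrable (fun u : E ↦ w ⟪m, u⟫ ^ 2) (stdGaussian E) :=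
    .of_bound (hmeas.pow_const 2).aestronglyMeasurable (C ^ 2) (.of_forall fun u ↦ by
      rw [norm_pow]; exact pow_le_pow_left₀ (norm_nonneg _) (hC _) 2)
  have hexp : (fun p : E × E ↦ ‖w ⟪m, p.1⟫ • m - κ • p.2‖ ^ 2) = fun p : E × E ↦
      (w ⟪m, p.1⟫ ^ 2 * (1 : ℝ) - w ⟪m, p.1⟫ * (2 * κ * ⟪m, p.2⟫)) +
        (1 : ℝ) * (κ ^ 2 * ‖p.2‖ ^ 2) := by
    ext p
    rw [norm_sub_sq_real, norm_smul, norm_smul, inner_smul_left, inner_smul_right, hm, mul_pow,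
      mul_pow, Real.norm_eq_abs, Real.norm_eq_abs, sq_abs, sq_abs]
    simp only [conj_trivial]
    ring
  have h1 := hint2.mul_prod (integrable_const (μ := stdGaussian E) (1 : ℝ))
  have h2 := hint.mul_prod ((integrable_inner_stdGaussian m).const_mul (2 * κ))
  have h3 := (integrable_const (μ := stdGaussian E) (1 : ℝ)).mul_prod
    ((integrable_norm_sq_stdGaussian (E := E)).const_mul (κ ^ 2))
  have h12 : Integrable (fun p : E × E ↦
      w ⟪m, p.1⟫ ^ 2 * (1 : ℝ) - w ⟪m, p.1⟫ * (2 * κ * ⟪m, p.2⟫))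
      ((stdGaussian E).prod (stdGaussian E)) := h1.sub h2
  rw [hexp]
  refine ⟨h12.add h3, ?_⟩
  rw [integral_add h12 h3, integral_sub h1 h2,
    integral_prod_mul (fun u : E ↦ w ⟪m, u⟫ ^ 2) (fun _ ↦ (1 : ℝ)),
    integral_prod_mul (fun u : E ↦ w ⟪m, u⟫) (fun v ↦ 2 * κ * ⟪m, v⟫),
    integral_prod_mul (fun _ : E ↦ (1 : ℝ)) (fun v : E ↦ κ ^ 2 * ‖v‖ ^ 2),
    integral_const_mul, integral_const_mul, integral_inner_stdGaussian,
    integral_norm_sq_stdGaussian, ← map_inner_stdGaussian hm,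
    integral_map (by fun_prop) (hw.pow_const 2).aestronglyMeasurable]
  simp

end stdGaussian

lemma Real.exists_cos_eq_sin_eq {x y : ℝ} (hy : 0 ≤ y) (h : x ^ 2 + y ^ 2 = 1) :
    ∃ θ : ℝ, Real.cos θ = x ∧ Real.sin θ = y := by
  refine ⟨Real.arccos x, Real.cos_arccos (by nlinarith) (by nlinarith), ?_⟩
  rw [Real.sin_arccos, ← h, add_sub_cancel_left, Real.sqrt_sq hy]

lemma Real.continuous_tanh : Continuous Real.tanh := by
  simp_rw [funext Real.tanh_eq_sinh_div_cosh]
  exact Real.continuous_sinh.div Real.continuous_cosh fun x ↦ (Real.cosh_pos x).ne'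

lemma integral_sub_tanh_sq_gaussianReal (p q : ℝ) :
    ∫ z, (1 - Real.tanh (p + q * z)) ^ 2 ∂gaussianReal 0 1 =
      1 - 2 * ∫ z, Real.tanh (p + q * z) ∂gaussianReal 0 1 +
        ∫ z, Real.tanh (p + q * z) ^ 2 ∂gaussianReal 0 1 := by
  have hc : Continuous fun z ↦ Real.tanh (p + q * z) := Real.continuous_tanh.comp (by fun_prop)
  have hb (z : ℝ) : ‖Real.tanh (p + q * z)‖ ≤ 1 := (Real.abs_tanh_lt_one _).le
  have h1 : Integrable (fun z ↦ 2 * Real.tanh (p + q * z)) (gaussianReal 0 1) :=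
    (Integrable.of_bound hc.aestronglyMeasurable 1 (.of_forall hb)).const_mul 2
  have h2 : Integrable (fun z ↦ Real.tanh (p + q * z) ^ 2) (gaussianReal 0 1) :=
    .of_bound (hc.pow 2).aestronglyMeasurable 1 (.of_forall fun z ↦ by
      rw [norm_pow]; exact pow_le_one₀ (norm_nonneg _) (hb z))
  have h0 : Integrable (fun z ↦ 1 - 2 * Real.tanh (p + q * z)) (gaussianReal 0 1) :=
    (integrable_const 1).sub h1
  have hexp (z : ℝ) : (1 - Real.tanh (p + q * z)) ^ 2 =
      1 - 2 * Real.tanh (p + q * z) + Real.tanh (p + q * z) ^ 2 := by ring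
  simp_rw [hexp]
  rw [integral_add h0 h2, integral_sub (integrable_const 1) h1, integral_const_mul]
  simp

lemma integral_comp_neg_gaussianReal (f : ℝ → ℝ) :
    ∫ z, f (-z) ∂gaussianReal 0 1 = ∫ z, f z ∂gaussianReal 0 1 := by
  have h : MeasurePreserving (Neg.neg : ℝ → ℝ) (gaussianReal 0 1) (gaussianReal 0 1) :=
    ⟨measurable_neg, by simpa using gaussianReal_map_neg (μ := 0) (v := 1)⟩
  exact h.integral_comp (MeasurableEquiv.neg ℝ).measurableEmbedding f

/-- The error of the oracle denoiser on the cluster with label `s`. -/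
lemma integral_norm_sq_oracle_residual {d : ℕ} {Δ σ : ℝ} (hΔ : Δ ∈ Set.Ioo (0 : ℝ) 1)
    (hσ : 0 < σ) {μ : EuclideanSpace ℝ (Fin d)} (hμ : ‖μ‖ = 1) {τ2 τ b a : ℝ}
    (hτ2 : τ2 = (1 - Δ) * σ ^ 2 + Δ) (hτ : τ = Real.sqrt τ2)
    (hb : b = Real.sqrt (1 - Δ) * σ ^ 2 / τ2) (ha : a = Δ / τ2)
    {t : EuclideanSpace ℝ (Fin d) → EuclideanSpace ℝ (Fin d)}
    (ht : ∀ y, t y = b • y + (a * Real.tanh (Real.sqrt (1 - Δ) * ⟪μ, y⟫ / τ2)) • μ) (s : ℝ) :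
    ∫ η : EuclideanSpace ℝ (Fin d), ∫ ξ : EuclideanSpace ℝ (Fin d),
        stdGaussVec d η * stdGaussVec d ξ *
          ‖(s • μ + σ • η) -
              t (Real.sqrt (1 - Δ) • (s • μ + σ • η) + Real.sqrt Δ • ξ)‖ ^ 2 =
      a ^ 2 * ∫ z, (s - Real.tanh ((1 - Δ) / τ2 * s + Real.sqrt (1 - Δ) * τ / τ2 * z)) ^ 2
          ∂gaussianReal 0 1 + d * Δ * σ ^ 2 / τ2 := by
  obtain ⟨hΔ0, hΔ1⟩ := hΔ
  have hc2 : Real.sqrt (1 - Δ) ^ 2 = 1 - Δ := Real.sq_sqrt (by linarith)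
  have hr2 : Real.sqrt Δ ^ 2 = Δ := Real.sq_sqrt hΔ0.le
  have hr : 0 < Real.sqrt Δ := Real.sqrt_pos.2 hΔ0
  have hτ2pos : 0 < τ2 := by
    have : 0 < (1 - Δ) * σ ^ 2 := mul_pos (by linarith) (by positivity)
    linarith
  have hτpos : 0 < τ := hτ ▸ Real.sqrt_pos.2 hτ2pos
  have hττ : τ ^ 2 = τ2 := hτ ▸ Real.sq_sqrt hτ2pos.le
  clear hτ
  set c := Real.sqrt (1 - Δ)
  set r := Real.sqrt Δ
  subst hττ
  obtain ⟨θ, hcos, hsin⟩ := Real.exists_cos_eq_sin_eq (x := c * σ / τ) (y := r / τ)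
    (by positivity) (by
      rw [div_pow, div_pow, mul_pow, hc2, hr2, ← add_div, ← hτ2, div_self hτ2pos.ne'])
  set κ := σ * r / τ with hκ
  set w : ℝ → ℝ := fun z ↦ a * (s - Real.tanh ((1 - Δ) / τ ^ 2 * s + c * τ / τ ^ 2 * z)) with hw
  have hbc : 1 - c * b = a := by
    rw [hb, ha]
    field_simp
    rw [hc2, hτ2]
    ring
  have hη : σ * a = κ * (r / τ) := by
    rw [ha, hκ]
    field_simp
    rw [hr2]
  have hξ : b * r = κ * (c * σ / τ) := by
    rw [hb, hκ]
    field_simp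
  have hres (p : EuclideanSpace ℝ (Fin d) × EuclideanSpace ℝ (Fin d)) :
      (s • μ + σ • p.1) - t (c • (s • μ + σ • p.1) + r • p.2) =
        w ⟪μ, (ContinuousLinearMap.rotation θ p).1⟫ • μ -
          κ • (ContinuousLinearMap.rotation θ p).2 := by
    have harg : c * ⟪μ, c • (s • μ + σ • p.1) + r • p.2⟫ / τ ^ 2 =
        (1 - Δ) / τ ^ 2 * s + c * τ / τ ^ 2 * ⟪μ, (c * σ / τ) • p.1 + (r / τ) • p.2⟫ := by
      simp only [inner_add_right, inner_smul_right, real_inner_self_eq_norm_sq, hμ, ← hc2]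
      field_simp
      ring
    rw [ht, harg, ContinuousLinearMap.rotation_apply, hcos, hsin]
    simp only [hw]
    match_scalars
    · linear_combination s * hbc
    · linear_combination σ * hbc + hη
    · linear_combination -hξ
  obtain ⟨hint, hval⟩ := integral_norm_sq_smul_sub_smul hμ κ (w := w) (C := |a| * (|s| + 1))
    (measurable_const.mul (measurable_const.sub
      (Real.continuous_tanh.measurable.comp (by fun_prop)))) fun z ↦ by
      rw [hw, abs_mul]
      gcongr
      exact (abs_sub _ _).trans (by gcongr; exact (Real.abs_tanh_lt_one _).le)
  have hrot := measurePreserving_rotation_stdGaussian (E := EuclideanSpace ℝ (Fin d)) θ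
  have hint' := hrot.integrable_comp_of_integrable hint
  have hval' := integral_map (μ := (stdGaussian (EuclideanSpace ℝ (Fin d))).prod (stdGaussian _))
    hrot.aemeasurable (hrot.map_eq.symm ▸ hint.aestronglyMeasurable)
  rw [hrot.map_eq, hval] at hval'
  simp only [Function.comp_def, ← hres] at hint' hval'
  simp_rw [mul_assoc, integral_const_mul, integral_stdGaussVec_mul]
  rw [← integral_prod _ hint', ← hval']
  simp only [hw, mul_pow, integral_const_mul, hκ, div_pow, hr2, finrank_euclideanSpace,
    Fintype.card_fin]
  ring

/-- Exact expression for the test MSE of the oracle (Tweedie) denoiser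
`t(y) = b·y + a·tanh(√(1−Δ)·μᵀy/τ²)·μ` on the balanced binary isotropic Gaussian mixture
with clusters `±μ`, `‖μ‖ = 1`, and covariance `σ²·I_d`, observed through the channel
`x̃ = √(1−Δ)x + √Δξ`. -/
theorem oracle_denoiser_mse {d : ℕ} (hd : 1 ≤ d) (Δ : ℝ) (hΔ : Δ ∈ Set.Ioo (0 : ℝ) 1)
    (σ : ℝ) (hσ : 0 < σ) (μ : EuclideanSpace ℝ (Fin d)) (hμ : ‖μ‖ = 1)
    (τ2 τ b a : ℝ)
    (hτ2 : τ2 = (1 - Δ) * σ ^ 2 + Δ) (hτ : τ = Real.sqrt τ2)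
    (hb : b = Real.sqrt (1 - Δ) * σ ^ 2 / τ2) (ha : a = Δ / τ2)
    (t : EuclideanSpace ℝ (Fin d) → EuclideanSpace ℝ (Fin d))
    (ht : ∀ y, t y = b • y + (a * Real.tanh (Real.sqrt (1 - Δ) * ⟪μ, y⟫ / τ2)) • μ)
    (F : ℝ → ℝ)
    (hF : ∀ s : ℝ, F s =
      ∫ η : EuclideanSpace ℝ (Fin d), ∫ ξ : EuclideanSpace ℝ (Fin d),
        stdGaussVec d η * stdGaussVec d ξ *
          ‖(s • μ + σ • η) -
              t (Real.sqrt (1 - Δ) • (s • μ + σ • η) + Real.sqrt Δ • ξ)‖ ^ 2) :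
    (1 / 2) * (F 1 + F (-1))
      =
    (d : ℝ) * Δ * b ^ 2 + (1 - Real.sqrt (1 - Δ) * b) ^ 2 * (1 + (d : ℝ) * σ ^ 2) +
      a ^ 2 * (∫ z : ℝ, stdGauss1 z *
        Real.tanh (((1 - Δ) + Real.sqrt (1 - Δ) * τ * z) / τ2) ^ 2) -
      2 * a * (1 - Real.sqrt (1 - Δ) * b) * (∫ z : ℝ, stdGauss1 z *
        Real.tanh (((1 - Δ) + Real.sqrt (1 - Δ) * τ * z) / τ2)) := by
  have hτ2pos : 0 < τ2 := by
    have : 0 < (1 - Δ) * σ ^ 2 := mul_pos (by linarith [hΔ.2]) (by positivity)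
    linarith [hΔ.1]
  have hc2 : Real.sqrt (1 - Δ) ^ 2 = 1 - Δ := Real.sq_sqrt (by linarith [hΔ.2])
  have hbc : 1 - Real.sqrt (1 - Δ) * b = a := by
    rw [hb, ha]
    field_simp
    rw [hc2, hτ2]
    ring
  have hF' (s : ℝ) := (hF s).trans (integral_norm_sq_oracle_residual hΔ hσ hμ hτ2 hτ hb ha ht s)
  have hsymm : F (-1) = F 1 := by
    rw [hF', hF', ← integral_comp_neg_gaussianReal]
    congr with z
    rw [show (1 - Δ) / τ2 * -1 + √(1 - Δ) * τ / τ2 * -z =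
      -((1 - Δ) / τ2 * 1 + √(1 - Δ) * τ / τ2 * z) by ring, Real.tanh_neg]
    ring
  have harg (z : ℝ) : ((1 - Δ) + √(1 - Δ) * τ * z) / τ2 =
      (1 - Δ) / τ2 * 1 + √(1 - Δ) * τ / τ2 * z := by ring
  rw [hsymm, hF', integral_sub_tanh_sq_gaussianReal, integral_stdGauss1_mul,
    integral_stdGauss1_mul, hbc]
  simp_rw [harg]
  have hscal : (d : ℝ) * Δ * b ^ 2 + a ^ 2 * (d * σ ^ 2) = d * Δ * σ ^ 2 / τ2 := by
    rw [hb, ha, div_pow, mul_pow, hc2]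
    field_simp
    rw [hτ2]
  linear_combination -hscal
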